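/- arXiv:0804.2219 — 2 statements merged into one kernel-verified Lean document; each statement's English description precedes it below -/
import Mathlib

section
/- Let A = ℂ[x_1, x_2, x_3], f_4 = (x_1·x_3 + x_2)·(x_1^4 − x_2^4), and g_j = ∂f_4/∂x_j for j = 1, 2, 3. Then s^2·p ∈ ker^{(1)}φ for every p ∈ ker φ, but there exists p ∈ ker φ with s·p ∉ ker^{(1)}φ. In other words, the divisor D_4 satisfies property (GCL) with minimal exponent N = 2. -/
open MvPolynomial

set_option synthInstance.maxHeartbeats 1000000
set_option maxHeartbeats 1000000

/-- The `A`-algebra map `φ : A[s, ξ_1, …, ξ_n] → A[t]` with `φ(s) = f·t` and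
`φ(ξ_j) = g_j·t`; variable `0` is `s` and variable `j.succ` is `ξ_j`. Its image is the
Rees algebra of the ideal `(f, g_1, …, g_n)`. -/
noncomputable def reesPhi {A : Type*} [CommRing A] {n : ℕ} (f : A) (g : Fin n → A) :
    MvPolynomial (Fin (n + 1)) A →ₐ[A] Polynomial A :=
  aeval (Fin.cons (Polynomial.C f * Polynomial.X) fun j => Polynomial.C (g j) * Polynomial.X)

/-- `ker^{(1)} φ`: the ideal of `A[s, ξ_1, …, ξ_n]` generated by the homogeneous
elements of degree `1` lying in `ker φ`. -/
noncomputable def kerOne {A : Type*} [CommRing A] {n : ℕ} (f : A) (g : Fin n → A) :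
    Ideal (MvPolynomial (Fin (n + 1)) A) :=
  Ideal.span {p | p ∈ RingHom.ker (reesPhi f g) ∧ p.IsHomogeneous 1}

/-- The member `k = 4` of the family `D_k`: `f_4 = (x_1·x_3 + x_2)·(x_1^4 − x_2^4)` in
`ℂ[x_1, x_2, x_3]`. -/
noncomputable def fD4 : MvPolynomial (Fin 3) ℂ :=
  (X 0 * X 2 + X 1) * (X 0 ^ 4 - X 1 ^ 4)


/-- The coefficient of `x z + y` in the second generator of the logarithmic relations. -/
def relU {R : Type*} [CommRing R] (x y z b c e : R) : R :=
  b * (x * z + y) * (5 * (x * z + y) - 16 * x * z) +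
    e * (4 * z * (x * z + y) ^ 2 + 60 * (x * z + y) * x * z ^ 2 - 20 * x ^ 2 * z ^ 3) +
    c * (90 * z ^ 2 * (x * z + y) - 40 * x * z ^ 3)

/-- The coefficient of `x ^ 2` in the second generator of the logarithmic relations. -/
def relV {R : Type*} [CommRing R] (z c : R) : R := 5 * (z ^ 4 - 1) * c

/-- The first linear relation. -/
def relOne {R : Type*} [CommRing R] (x y z b c e : R) : R :=
  x ^ 2 * b - (x * z + y) * (4 * x * e + 5 * c)

/-- The second linear relation. -/
def relTwo {R : Type*} [CommRing R] (x y z b c e : R) : R :=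
  (x * z + y) * relU x y z b c e + x ^ 2 * relV z c

/-- The quadratic relation: the determinant of the coefficients of the two linear relations
with respect to `x z + y` and `x ^ 2`. -/
def relDet {R : Type*} [CommRing R] (x y z b c e : R) : R :=
  relU x y z b c e * b + (4 * x * e + 5 * c) * relV z c

section map

variable {R S : Type*} [CommRing R] [CommRing S] (f : R →+* S) (x y z b c e : R)

theorem map_relU : f (relU x y z b c e) = relU (f x) (f y) (f z) (f b) (f c) (f e) := by
  simp [relU, _root_.map_ofNat]

theorem map_relV : f (relV z c) = relV (f z) (f c) := by
  simp [relV, _root_.map_ofNat]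

theorem map_relOne : f (relOne x y z b c e) = relOne (f x) (f y) (f z) (f b) (f c) (f e) := by
  simp [relOne, _root_.map_ofNat]

theorem map_relTwo : f (relTwo x y z b c e) = relTwo (f x) (f y) (f z) (f b) (f c) (f e) := by
  simp [relTwo, map_relU, map_relV]

theorem map_relDet : f (relDet x y z b c e) = relDet (f x) (f y) (f z) (f b) (f c) (f e) := by
  simp [relDet, map_relU, map_relV, _root_.map_ofNat]

end map

/-- A nonzero element `w` is regular modulo the ideal of `2 × 2` minors of a `3 × 2` matrix
containing the row `(w, v)`, if the minors behave well modulo `w`. -/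
theorem mem_span_minors_of_mul_mem {R : Type*} [CommRing R] [IsDomain R] {w v a b U V : R}
    (hw : w ≠ 0) (hv : ∀ X, w ∣ v * X → w ∣ X)
    (hdet : ∀ X Y, w ∣ v * X + (U * b + a * V) * Y → ∃ k, w ∣ Y - v * k)
    (hrow : ∀ X Y, w ∣ b * X + V * Y → ∃ k, w ∣ X - V * k ∧ w ∣ Y + b * k) {p : R}
    (hp : w * p ∈ Ideal.span {v * b - w * a, w * U + v * V, U * b + a * V}) :
    p ∈ Ideal.span {v * b - w * a, w * U + v * V, U * b + a * V} := by
  rw [Ideal.mem_span_insert] at hp ⊢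
  obtain ⟨α, q, hq, hp⟩ := hp
  obtain ⟨β, γ, rfl⟩ := Ideal.mem_span_pair.1 hq
  obtain ⟨γ', δ, hδ⟩ := hdet (α * b + β * V) γ ⟨p + α * a - β * U, by linear_combination -hp⟩
  obtain ⟨k, ⟨μ, hμ⟩, ν, hν⟩ := hrow (α + γ' * U) (β + γ' * a) <|
    hv _ ⟨p + α * a - β * U - δ * (U * b + a * V), by
      linear_combination -hp - (U * b + a * V) * hδ⟩
  refine ⟨μ, _, Ideal.mem_span_pair.2 ⟨ν, δ - k, rfl⟩, mul_left_cancel₀ hw ?_⟩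
  linear_combination hp + (U * b + a * V) * hδ + (v * b - w * a) * hμ + (w * U + v * V) * hν

/-- If the generators of an algebra can be moved into a subalgebra `S` modulo `I` after
multiplication by `u ∈ S`, then every element can be, after multiplication by a power of `u`. -/
theorem exists_pow_mul_sub_mem {A R : Type*} [CommRing A] [CommRing R] [Algebra A R]
    (I : Ideal R) (S : Subalgebra A R) {T : Set R} {u : R} (hu : u ∈ S)
    (hT : ∀ g ∈ T, ∃ q ∈ S, u * g - q ∈ I) {p : R} (hp : p ∈ Algebra.adjoin A T) :
    ∃ d : ℕ, ∃ q ∈ S, u ^ d * p - q ∈ I := by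
  induction hp using Algebra.adjoin_induction with
  | mem g hg =>
    obtain ⟨q, hq, h⟩ := hT g hg
    exact ⟨1, q, hq, by simpa using h⟩
  | algebraMap r => exact ⟨0, _, S.algebraMap_mem r, by simp⟩
  | add p₁ p₂ _ _ h₁ h₂ =>
    obtain ⟨d₁, q₁, hq₁, h₁⟩ := h₁
    obtain ⟨d₂, q₂, hq₂, h₂⟩ := h₂
    refine ⟨d₁ + d₂, u ^ d₂ * q₁ + u ^ d₁ * q₂,
      S.add_mem (S.mul_mem (S.pow_mem hu _) hq₁) (S.mul_mem (S.pow_mem hu _) hq₂), ?_⟩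
    convert I.add_mem (I.mul_mem_left (u ^ d₂) h₁) (I.mul_mem_left (u ^ d₁) h₂) using 1
    ring
  | mul p₁ p₂ _ _ h₁ h₂ =>
    obtain ⟨d₁, q₁, hq₁, h₁⟩ := h₁
    obtain ⟨d₂, q₂, hq₂, h₂⟩ := h₂
    refine ⟨d₁ + d₂, q₁ * q₂, S.mul_mem hq₁ hq₂, ?_⟩
    convert I.add_mem (I.mul_mem_left (u ^ d₂ * p₂) h₁) (I.mul_mem_left q₁ h₂) using 1
    ring

/-- A ring endomorphism that is the identity modulo `I` detects membership in `I`. -/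
theorem mem_of_map_eq_zero {R : Type*} [CommRing R] {I : Ideal R} {ρ : R →+* R}
    (hρ : (Ideal.Quotient.mk I).comp ρ = Ideal.Quotient.mk I) {p : R} (hp : ρ p = 0) :
    p ∈ I := by
  rw [← Ideal.Quotient.eq_zero_iff_mem, ← hρ, RingHom.comp_apply, hp, map_zero]

/-- The coordinate ring `ℂ[x, y, z]`. -/
abbrev CoordRing : Type := MvPolynomial (Fin 3) ℂ

/-- The polynomial ring `ℂ[x, y, z][b, c, e]`. -/
abbrev SymbolRing : Type := MvPolynomial (Fin 3) CoordRing

/-- The ring homomorphism out of `ℂ[x, y, z][b, c, e]` with prescribed values on the variables. -/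
noncomputable def symbolHom {R : Type*} [CommRing R] [Algebra ℂ R] (v u : Fin 3 → R) :
    SymbolRing →+* R :=
  eval₂Hom (aeval v).toRingHom u

@[simp] theorem symbolHom_C_X {R : Type*} [CommRing R] [Algebra ℂ R] (v u : Fin 3 → R)
    (i : Fin 3) : symbolHom v u (C (X i)) = v i := by simp [symbolHom]

@[simp] theorem symbolHom_X {R : Type*} [CommRing R] [Algebra ℂ R] (v u : Fin 3 → R)
    (i : Fin 3) : symbolHom v u (X i) = u i := by simp [symbolHom]

@[simp] theorem symbolHom_C_C {R : Type*} [CommRing R] [Algebra ℂ R] (v u : Fin 3 → R)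
    (r : ℂ) : symbolHom v u (C (C r)) = algebraMap ℂ R r := by simp [symbolHom]

theorem mem_of_symbolHom_eq_zero {I : Ideal SymbolRing} {v u : Fin 3 → SymbolRing}
    (hv : ∀ i, v i - C (X i) ∈ I) (hu : ∀ i, u i - X i ∈ I) {p : SymbolRing}
    (hp : symbolHom v u p = 0) : p ∈ I := by
  refine mem_of_map_eq_zero (MvPolynomial.ringHom_ext' (MvPolynomial.ringHom_ext' ?_ ?_) ?_) hp
  · ext r
    simp [algebraMap_eq]
  · intro i
    simpa [Ideal.Quotient.mk_eq_mk_iff_sub_mem] using hv i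
  · intro i
    simpa [Ideal.Quotient.mk_eq_mk_iff_sub_mem] using hu i

local notation "𝐱" => (C (X 0 : CoordRing) : SymbolRing)
local notation "𝐲" => (C (X 1 : CoordRing) : SymbolRing)
local notation "𝐳" => (C (X 2 : CoordRing) : SymbolRing)
local notation "𝐛" => (X 0 : SymbolRing)
local notation "𝐜" => (X 1 : SymbolRing)
local notation "𝐞" => (X 2 : SymbolRing)

theorem prime_coord_w : Prime (X 0 * X 2 + X 1 : CoordRing) := by
  apply Irreducible.prime
  apply irreducible_mul_X_add _ _ _ (X_ne_zero _)
  · simp [vars_X]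
  · simp [vars_X]
  · exact (Irreducible.isRelPrime_iff_not_dvd (X_prime).irreducible).2 (by simp [X_dvd_X])

theorem prime_coord_m : Prime (X 1 ^ 3 * X 2 + X 0 ^ 3 : CoordRing) := by
  apply Irreducible.prime
  apply irreducible_mul_X_add _ _ _ (pow_ne_zero _ (X_ne_zero _))
  · exact fun h => by simpa [vars_X] using vars_pow _ _ h
  · exact fun h => by simpa [vars_X] using vars_pow _ _ h
  · exact (Irreducible.isRelPrime_iff_not_dvd (X_prime).irreducible |>.2 (by simp [X_dvd_X])).pow

theorem prime_w : Prime (𝐱 * 𝐳 + 𝐲) := by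
  simpa using (prime_C_iff (σ := Fin 3)).2 prime_coord_w

theorem prime_m : Prime (𝐲 ^ 3 * 𝐳 + 𝐱 ^ 3) := by
  simpa using (prime_C_iff (σ := Fin 3)).2 prime_coord_m

theorem not_dvd_of_symbolHom {R : Type*} [CommRing R] [Algebra ℂ R] {p q : SymbolRing}
    (v u : Fin 3 → R) (hp : symbolHom v u p = 0) (hq : symbolHom v u q ≠ 0) : ¬ p ∣ q := by
  rintro ⟨r, rfl⟩
  exact hq (by rw [map_mul, hp, zero_mul])

/-- The ideal of the Rees algebra in `ℂ[x, y, z][b, c, e]`. -/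
noncomputable def reesIdeal : Ideal SymbolRing :=
  Ideal.span {relOne 𝐱 𝐲 𝐳 𝐛 𝐜 𝐞, relTwo 𝐱 𝐲 𝐳 𝐛 𝐜 𝐞, relDet 𝐱 𝐲 𝐳 𝐛 𝐜 𝐞}

theorem w_dvd_of_dvd_x_mul {p : SymbolRing} (h : 𝐱 * 𝐳 + 𝐲 ∣ 𝐱 * p) : 𝐱 * 𝐳 + 𝐲 ∣ p :=
  (prime_w.dvd_or_dvd h).resolve_left
    (not_dvd_of_symbolHom (R := ℂ) ![1, 0, 0] 0 (by simp) (by simp))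

theorem exists_of_w_dvd_det {X' Y : SymbolRing}
    (h : 𝐱 * 𝐳 + 𝐲 ∣ 𝐱 * X' + relDet 𝐱 𝐲 𝐳 𝐛 𝐜 𝐞 * Y) :
    ∃ k, 𝐱 * 𝐳 + 𝐲 ∣ Y - 𝐱 * k := by
  have hmem : Y ∈ Ideal.span {𝐱 * 𝐳 + 𝐲, 𝐱} := by
    apply mem_of_symbolHom_eq_zero (v := ![0, 0, 𝐳]) (u := X)
    · intro i
      fin_cases i
      · simpa using Ideal.subset_span (by simp)
      · rw [Ideal.mem_span_pair]
        exact ⟨-1, 𝐳, by simp; ring⟩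
      · simp
    · simp
    · obtain ⟨r, hr⟩ := h
      have := congrArg (symbolHom ![0, 0, 𝐳] X) hr
      simp [map_relDet] at this
      simp [relDet, relU, relV] at this
      have h1 : (𝐳 ^ 4 - 1) ≠ 0 := fun h0 => by
        have := congrArg (symbolHom (R := ℂ) 0 0) h0
        simp at this
      exact this.resolve_left h1
  obtain ⟨δ, k, rfl⟩ := Ideal.mem_span_pair.1 hmem
  exact ⟨k, δ, by ring⟩

theorem exists_of_w_dvd_row {X' Y : SymbolRing} (h : 𝐱 * 𝐳 + 𝐲 ∣ 𝐛 * X' + relV 𝐳 𝐜 * Y) :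
    ∃ k, 𝐱 * 𝐳 + 𝐲 ∣ X' - relV 𝐳 𝐜 * k ∧ 𝐱 * 𝐳 + 𝐲 ∣ Y + 𝐛 * k := by
  have hmem : Y ∈ Ideal.span {𝐱 * 𝐳 + 𝐲, 𝐛} := by
    apply mem_of_symbolHom_eq_zero (v := ![𝐱, -(𝐱 * 𝐳), 𝐳]) (u := ![0, 𝐜, 𝐞])
    · intro i
      fin_cases i
      · simp
      · rw [Ideal.mem_span_pair]
        exact ⟨-1, 0, by simp; ring⟩
      · simp
    · intro i
      fin_cases i
      · simpa using Ideal.subset_span (by simp)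
      · simp
      · simp
    · obtain ⟨r, hr⟩ := h
      have := congrArg (symbolHom ![𝐱, -(𝐱 * 𝐳), 𝐳] ![0, 𝐜, 𝐞]) hr
      simp [map_relV] at this
      simp [relV] at this
      have h1 : (𝐳 ^ 4 - 1) ≠ 0 := fun h0 => by
        have := congrArg (symbolHom (R := ℂ) 0 0) h0
        simp at this
      exact this.resolve_left h1
  obtain ⟨δ, k, rfl⟩ := Ideal.mem_span_pair.1 hmem
  refine ⟨-k, ?_, δ, by ring⟩
  have hb : ¬ 𝐱 * 𝐳 + 𝐲 ∣ 𝐛 :=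
    not_dvd_of_symbolHom (R := ℂ) 0 ![1, 0, 0] (by simp) (by simp)
  refine (prime_w.dvd_or_dvd ?_).resolve_left hb
  obtain ⟨r, hr⟩ := h
  exact ⟨r - relV 𝐳 𝐜 * δ, by linear_combination hr⟩

theorem mem_reesIdeal_of_w_mul_mem {p : SymbolRing} (h : (𝐱 * 𝐳 + 𝐲) * p ∈ reesIdeal) :
    p ∈ reesIdeal := by
  refine mem_span_minors_of_mul_mem (v := 𝐱 ^ 2) prime_w.ne_zero (fun X' hX => ?_)
    (fun X' Y hY => ?_) (fun X' Y => exists_of_w_dvd_row) h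
  · rw [pow_two, mul_assoc] at hX
    exact w_dvd_of_dvd_x_mul (w_dvd_of_dvd_x_mul hX)
  · change _ ∣ _ + relDet 𝐱 𝐲 𝐳 𝐛 𝐜 𝐞 * Y at hY
    rw [pow_two, mul_assoc] at hY
    obtain ⟨k, δ, hδ⟩ := exists_of_w_dvd_det hY
    obtain ⟨r, hr⟩ := hY
    obtain ⟨k', δ', hδ'⟩ := exists_of_w_dvd_det (X' := X') (Y := k) <| w_dvd_of_dvd_x_mul
      ⟨r - relDet 𝐱 𝐲 𝐳 𝐛 𝐜 𝐞 * δ, by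
        linear_combination hr - relDet 𝐱 𝐲 𝐳 𝐛 𝐜 𝐞 * hδ⟩
    exact ⟨k', δ + 𝐱 * δ', by linear_combination hδ + 𝐱 * hδ'⟩

/-- The derivative of `f_4` along `b`, the lift of `∂_x` fixing `x z + y` and `z`. -/
noncomputable def coordF : CoordRing := 4 * (X 0 * X 2 + X 1) * (X 1 ^ 3 * X 2 + X 0 ^ 3)

/-- The derivative of `f_4` along `e = ∂_y`. -/
noncomputable def coordG : CoordRing :=
  X 0 ^ 4 - X 1 ^ 4 - 4 * (X 0 * X 2 + X 1) * X 1 ^ 3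

/-- The derivative of `f_4` along `c`, the lift of `∂_z` fixing `x` and `x z + y`. -/
noncomputable def coordH : CoordRing := 4 * (X 0 * X 2 + X 1) * X 0 * X 1 ^ 3

/-- The Rees map in the variables `b`, `c`, `e`. -/
noncomputable def reesPsi : SymbolRing →ₐ[CoordRing] Polynomial CoordRing :=
  aeval ![Polynomial.C coordF * Polynomial.X, Polynomial.C coordH * Polynomial.X,
    Polynomial.C coordG * Polynomial.X]

@[simp] theorem reesPsi_C (a : CoordRing) : reesPsi (C a) = Polynomial.C a := by
  simp [reesPsi, Polynomial.algebraMap_eq]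

theorem reesPsi_b : reesPsi 𝐛 = Polynomial.C coordF * Polynomial.X := by simp [reesPsi]

theorem reesPsi_c : reesPsi 𝐜 = Polynomial.C coordH * Polynomial.X := by simp [reesPsi]

theorem reesPsi_e : reesPsi 𝐞 = Polynomial.C coordG * Polynomial.X := by simp [reesPsi]

theorem reesPsi_relOne : reesPsi (relOne 𝐱 𝐲 𝐳 𝐛 𝐜 𝐞) = 0 := by
  refine (map_relOne reesPsi.toRingHom _ _ _ _ _ _).trans ?_
  simp [reesPsi_b, reesPsi_c, reesPsi_e, coordF, coordG, coordH, relOne, _root_.map_ofNat]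
  ring

theorem reesPsi_relTwo : reesPsi (relTwo 𝐱 𝐲 𝐳 𝐛 𝐜 𝐞) = 0 := by
  refine (map_relTwo reesPsi.toRingHom _ _ _ _ _ _).trans ?_
  simp [reesPsi_b, reesPsi_c, reesPsi_e, coordF, coordG, coordH, relTwo, relU, relV,
    _root_.map_ofNat]
  ring

theorem reesPsi_relDet : reesPsi (relDet 𝐱 𝐲 𝐳 𝐛 𝐜 𝐞) = 0 := by
  refine (map_relDet reesPsi.toRingHom _ _ _ _ _ _).trans ?_
  simp [reesPsi_b, reesPsi_c, reesPsi_e, coordF, coordG, coordH, relDet, relU, relV,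
    _root_.map_ofNat]
  ring

theorem reesIdeal_le_ker : reesIdeal ≤ RingHom.ker reesPsi := by
  rw [reesIdeal, Ideal.span_le]
  rintro _ (rfl | rfl | rfl)
  exacts [reesPsi_relOne, reesPsi_relTwo, reesPsi_relDet]

theorem isUnit_ofNat {R : Type*} [CommRing R] [Algebra ℂ R] (n : ℕ) [n.AtLeastTwo] :
    IsUnit (OfNat.ofNat n : R) := by
  have := (isUnit_iff_ne_zero.2 (OfNat.ofNat_ne_zero (R := ℂ) n)).map (algebraMap ℂ R)
  rwa [_root_.map_ofNat] at this

theorem C_coordF :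
    (C coordF : SymbolRing) = 4 * (𝐱 * 𝐳 + 𝐲) * (𝐲 ^ 3 * 𝐳 + 𝐱 ^ 3) := by
  simp [coordF, _root_.map_ofNat]

theorem C_coordG :
    (C coordG : SymbolRing) = 𝐱 ^ 4 - 𝐲 ^ 4 - 4 * (𝐱 * 𝐳 + 𝐲) * 𝐲 ^ 3 := by
  simp [coordG, _root_.map_ofNat]

theorem coordF_ne_zero : coordF ≠ 0 :=
  mul_ne_zero (mul_ne_zero (isUnit_ofNat 4).ne_zero prime_coord_w.ne_zero) prime_coord_m.ne_zero

theorem coordF_mul_sub_mem : C coordF * 𝐞 - C coordG * 𝐛 ∈ reesIdeal := by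
  have h1 : relOne 𝐱 𝐲 𝐳 𝐛 𝐜 𝐞 ∈ reesIdeal := Ideal.subset_span (by simp)
  have h2 : relTwo 𝐱 𝐲 𝐳 𝐛 𝐜 𝐞 ∈ reesIdeal := Ideal.subset_span (by simp)
  convert reesIdeal.add_mem (reesIdeal.mul_mem_left (𝐱 * 𝐳 + 𝐲) h2)
    (reesIdeal.mul_mem_left ((𝐱 * 𝐳 + 𝐲) * (15 * (𝐱 * 𝐳 + 𝐲) * 𝐳 ^ 2 - 5 * 𝐱 * 𝐳 ^ 3) +
      (3 * 𝐳 ^ 2 * (𝐱 * 𝐳 + 𝐲) ^ 2 - 3 * (𝐱 * 𝐳 + 𝐲) * 𝐱 * 𝐳 ^ 3 + 𝐱 ^ 2 * (𝐳 ^ 4 - 1))) h1)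
    using 1
  rw [C_coordF, C_coordG, relOne, relTwo, relU, relV]
  ring

theorem coordF_dvd_of_dvd {p : SymbolRing} (h : C coordF ∣ C coordG * 𝐛 * p) :
    C coordF ∣ p := by
  rw [C_coordF, mul_assoc, (isUnit_ofNat 4).mul_left_dvd] at h ⊢
  have hw : 𝐱 * 𝐳 + 𝐲 ∣ p := by
    refine (prime_w.dvd_or_dvd ((dvd_mul_right _ _).trans h)).resolve_left fun h0 => ?_
    rw [C_coordG] at h0
    exact not_dvd_of_symbolHom (R := ℂ) ![1, 0, 0] 1 (by simp) (by simp) h0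
  obtain ⟨q, rfl⟩ := hw
  rw [mul_left_comm] at h
  refine mul_dvd_mul_left _ ((prime_m.dvd_or_dvd
    ((mul_dvd_mul_iff_left prime_w.ne_zero).1 h)).resolve_left fun h0 => ?_)
  rw [C_coordG] at h0
  refine not_dvd_of_symbolHom (R := ℂ) ![0, 1, 0] 1 (by simp) ?_ h0
  simp [_root_.map_ofNat]
  norm_num

theorem mem_span_of_coordF_pow_mul_mem {p : SymbolRing} (n : ℕ)
    (h : C coordF ^ n * p ∈ Ideal.span {C coordF * 𝐞 - C coordG * 𝐛}) :
    p ∈ Ideal.span {C coordF * 𝐞 - C coordG * 𝐛} := by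
  induction n with
  | zero => simpa using h
  | succ n ih =>
    refine ih ?_
    rw [pow_succ', mul_assoc, Ideal.mem_span_singleton] at h
    obtain ⟨r, hr⟩ := h
    obtain ⟨k, rfl⟩ : C coordF ∣ r := coordF_dvd_of_dvd
      ⟨𝐞 * r - C coordF ^ n * p, by linear_combination hr⟩
    have hF : (C coordF : SymbolRing) ≠ 0 := by simpa using coordF_ne_zero
    exact Ideal.mem_span_singleton.2 ⟨k, mul_left_cancel₀ hF (by linear_combination hr)⟩

theorem eq_zero_of_reesPsi_eq_zero {r : SymbolRing} (hr : r ∈ Algebra.adjoin CoordRing {𝐛})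
    (h : reesPsi r = 0) : r = 0 := by
  rw [Algebra.adjoin_singleton_eq_range_aeval] at hr
  obtain ⟨q, rfl⟩ := hr
  have hcomp : reesPsi (Polynomial.aeval 𝐛 q) =
      q.comp (Polynomial.C coordF * Polynomial.X) := by
    rw [← Polynomial.aeval_algHom_apply, reesPsi_b]
    rfl
  change reesPsi (Polynomial.aeval 𝐛 q) = 0 at h
  rw [hcomp, Polynomial.comp_C_mul_X_eq_zero_iff
    (mem_nonZeroDivisors_of_ne_zero coordF_ne_zero)] at h
  simp [h]

theorem mem_reesIdeal_of_reesPsi_eq_zero {p : SymbolRing} (hp : reesPsi p = 0) :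
    p ∈ reesIdeal := by
  have hC (T : Set SymbolRing) (a : CoordRing) : C a ∈ Algebra.adjoin CoordRing T :=
    Subalgebra.algebraMap_mem _ a
  have hb : 𝐛 ∈ Algebra.adjoin CoordRing {𝐛, 𝐞} := Algebra.subset_adjoin (by simp)
  have he : 𝐞 ∈ Algebra.adjoin CoordRing {𝐛, 𝐞} := Algebra.subset_adjoin (by simp)
  have h1 : relOne 𝐱 𝐲 𝐳 𝐛 𝐜 𝐞 ∈ reesIdeal := Ideal.subset_span (by simp)
  have h5 : (C (C (5⁻¹ : ℂ)) : SymbolRing) * 5 = 1 := by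
    rw [← _root_.map_ofNat C 5, ← _root_.map_ofNat C 5, ← C_mul, ← C_mul]
    simp
  obtain ⟨d, q, hq, hdq⟩ := exists_pow_mul_sub_mem (A := CoordRing) reesIdeal
    (Algebra.adjoin CoordRing {𝐛, 𝐞}) (u := C (X 0 * X 2 + X 1)) (hC _ _)
    (T := Set.range X) (p := p) (by
      rintro _ ⟨i, rfl⟩
      fin_cases i
      · exact ⟨C (X 0 * X 2 + X 1) * 𝐛, mul_mem (hC _ _) hb, by simp⟩
      · refine ⟨C (C 5⁻¹) * (C (X 0 ^ 2) * 𝐛 - C (4 * X 0 * (X 0 * X 2 + X 1)) * 𝐞),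
          mul_mem (hC _ _) (sub_mem (mul_mem (hC _ _) hb) (mul_mem (hC _ _) he)), ?_⟩
        convert reesIdeal.mul_mem_left (-C (C 5⁻¹)) h1 using 1
        simp only [relOne, map_add, map_mul, map_pow, _root_.map_ofNat, Fin.mk_one]
        linear_combination (-(𝐱 * 𝐳 + 𝐲) * 𝐜) * h5
      · exact ⟨C (X 0 * X 2 + X 1) * 𝐞, mul_mem (hC _ _) he, by simp⟩) (by
      rw [adjoin_range_X]; trivial)
  have hψq : reesPsi q = 0 := by
    have := reesIdeal_le_ker hdq
    rw [RingHom.mem_ker, map_sub, map_mul, hp, mul_zero, zero_sub, neg_eq_zero] at this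
    exact this
  obtain ⟨n, r, hr, hnr⟩ := exists_pow_mul_sub_mem (A := CoordRing)
    (Ideal.span {C coordF * 𝐞 - C coordG * 𝐛}) (Algebra.adjoin CoordRing {𝐛}) (u := C coordF)
    (hC _ _) (T := {𝐛, 𝐞}) (p := q) (by
      have hb : 𝐛 ∈ Algebra.adjoin CoordRing {𝐛} := Algebra.subset_adjoin (by simp)
      rintro _ (rfl | rfl)
      · exact ⟨C coordF * 𝐛, mul_mem (hC _ _) hb, by simp⟩
      · exact ⟨_, mul_mem (hC _ coordG) hb, Ideal.subset_span rfl⟩) hq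
  have hle : Ideal.span {C coordF * 𝐞 - C coordG * 𝐛} ≤ reesIdeal := by
    simpa [Ideal.span_le] using coordF_mul_sub_mem
  have hψr : reesPsi r = 0 := by
    have := reesIdeal_le_ker (hle hnr)
    rw [RingHom.mem_ker, map_sub, map_mul, hψq, mul_zero, zero_sub, neg_eq_zero] at this
    exact this
  rw [eq_zero_of_reesPsi_eq_zero hr hψr, sub_zero] at hnr
  have hw := (Submodule.sub_mem_iff_left _ (hle (mem_span_of_coordF_pow_mul_mem n hnr))).1 hdq
  clear hdq hψq
  induction d with
  | zero => simpa using hw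
  | succ d ih =>
    refine ih (mem_reesIdeal_of_w_mul_mem ?_)
    rw [pow_succ', mul_assoc] at hw
    simpa using hw

/-- The map `φ` of the divisor `D_4`. -/
noncomputable abbrev reesD4 :
    MvPolynomial (Fin 4) CoordRing →ₐ[CoordRing] Polynomial CoordRing :=
  reesPhi fD4 fun j => pderiv j fD4

/-- The ideal `ker^{(1)} φ` of the divisor `D_4`. -/
noncomputable abbrev kerOneD4 : Ideal (MvPolynomial (Fin 4) CoordRing) :=
  kerOne fD4 fun j => pderiv j fD4

/-- The inclusion of `ℂ[x, y, z][b, c, e]` given by `b = ξ_1 - z ξ_2`, `c = ξ_3 - x ξ_2`,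
`e = ξ_2`. -/
noncomputable def symbolIncl : SymbolRing →ₐ[CoordRing] MvPolynomial (Fin 4) CoordRing :=
  aeval ![X 1 - C (X 2) * X 2, X 3 - C (X 0) * X 2, X 2]

/-- The retraction of `symbolIncl` eliminating `s` through the Euler relation
`5 s = x ξ_1 + y ξ_2`. -/
noncomputable def symbolRetr : MvPolynomial (Fin 4) CoordRing →ₐ[CoordRing] SymbolRing :=
  aeval ![C (C 5⁻¹) * (𝐱 * 𝐛 + (𝐱 * 𝐳 + 𝐲) * 𝐞), 𝐛 + 𝐳 * 𝐞, 𝐞, 𝐜 + 𝐱 * 𝐞]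

theorem symbolRetr_s :
    symbolRetr (X 0) = C (C 5⁻¹) * (𝐱 * 𝐛 + (𝐱 * 𝐳 + 𝐲) * 𝐞) := by simp [symbolRetr]

theorem fD4_eq_C_inv_five_mul :
    fD4 = C 5⁻¹ * (X 0 * coordF + (X 0 * X 2 + X 1) * coordG) := by
  have h5 : (C 5⁻¹ : CoordRing) * 5 = 1 := by
    rw [← _root_.map_ofNat C 5, ← C_mul]
    simp
  rw [fD4, coordF, coordG]
  linear_combination (-(X 0 * X 2 + X 1) * (X 0 ^ 4 - X 1 ^ 4)) * h5

theorem pderiv_zero_fD4 : pderiv 0 fD4 = coordF + X 2 * coordG := by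
  simp [fD4, coordF, coordG, pderiv_X, Derivation.leibniz_pow]
  ring

theorem pderiv_one_fD4 : pderiv 1 fD4 = coordG := by
  simp [fD4, coordG, pderiv_X, Derivation.leibniz_pow]
  ring

theorem pderiv_two_fD4 : pderiv 2 fD4 = coordH + X 0 * coordG := by
  simp [fD4, coordH, coordG, pderiv_X, Derivation.leibniz_pow]
  ring

theorem reesPhi_X_zero {A : Type*} [CommRing A] {n : ℕ} (f : A) (g : Fin n → A) :
    reesPhi f g (X 0) = Polynomial.C f * Polynomial.X := by simp [reesPhi]

theorem reesPhi_X_succ {A : Type*} [CommRing A] {n : ℕ} (f : A) (g : Fin n → A) (j : Fin n) :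
    reesPhi f g (X j.succ) = Polynomial.C (g j) * Polynomial.X := by simp [reesPhi]

theorem reesPsi_comp_symbolRetr : reesPsi.comp symbolRetr = reesD4 := by
  refine algHom_ext fun i => ?_
  induction i using Fin.cases with
  | zero =>
    rw [reesPhi_X_zero, fD4_eq_C_inv_five_mul, AlgHom.comp_apply, symbolRetr_s]
    simp only [map_mul, map_add, reesPsi_C, reesPsi_b, reesPsi_e]
    ring
  | succ j =>
    rw [reesPhi_X_succ, AlgHom.comp_apply]
    fin_cases j
    · simp [symbolRetr, reesPsi_b, reesPsi_e, pderiv_zero_fD4]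
      ring
    · simp [symbolRetr, reesPsi_e, pderiv_one_fD4]
    · simp [symbolRetr, reesPsi_c, reesPsi_e, pderiv_two_fD4]
      ring

theorem symbolRetr_symbolIncl (p : SymbolRing) : symbolRetr (symbolIncl p) = p := by
  have : symbolRetr.comp symbolIncl = AlgHom.id _ _ := by
    refine algHom_ext fun i => ?_
    fin_cases i <;> simp [symbolRetr, symbolIncl]
  exact DFunLike.congr_fun this p

theorem reesPsi_symbolRetr (p : MvPolynomial (Fin 4) CoordRing) :
    reesPsi (symbolRetr p) = reesD4 p :=
  DFunLike.congr_fun reesPsi_comp_symbolRetr p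

theorem reesD4_symbolIncl (p : SymbolRing) : reesD4 (symbolIncl p) = reesPsi p := by
  rw [← reesPsi_symbolRetr, symbolRetr_symbolIncl]

theorem sub_symbolIncl_symbolRetr_mem (p : MvPolynomial (Fin 4) CoordRing) :
    p - symbolIncl (symbolRetr p) ∈ kerOneD4 := by
  have hs : (X 0 : MvPolynomial (Fin 4) CoordRing) - symbolIncl (symbolRetr (X 0)) ∈
      kerOneD4 := by
    refine Ideal.subset_span ⟨?_, ?_⟩
    · rw [RingHom.mem_ker, map_sub, reesD4_symbolIncl, reesPsi_symbolRetr, sub_self]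
    · convert (isHomogeneous_X CoordRing (0 : Fin 4)).sub
        ((isHomogeneous_C_mul_X (C 5⁻¹ * X 0 : CoordRing) (1 : Fin 4)).add
          (isHomogeneous_C_mul_X (C 5⁻¹ * X 1 : CoordRing) (2 : Fin 4))) using 1
      simp only [symbolRetr, symbolIncl, aeval_X, Matrix.cons_val_zero,
        Matrix.cons_val, map_mul, map_add, algHom_C, algebraMap_eq]
      ring
  have : (Ideal.Quotient.mkₐ CoordRing kerOneD4).comp (symbolIncl.comp symbolRetr) =
      Ideal.Quotient.mkₐ CoordRing kerOneD4 := by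
    refine algHom_ext fun i => ?_
    fin_cases i
    · exact (Ideal.Quotient.eq.2 hs).symm
    all_goals simp [symbolRetr, symbolIncl]
  exact Ideal.Quotient.eq.1 (DFunLike.congr_fun this p).symm

theorem isHomogeneous_linear_form (a b c : CoordRing) :
    (C a * 𝐛 + C b * 𝐜 + C c * 𝐞).IsHomogeneous 1 :=
  ((isHomogeneous_C_mul_X a _).add (isHomogeneous_C_mul_X b _)).add (isHomogeneous_C_mul_X c _)

theorem symbolIncl_mem_kerOne {p : SymbolRing} (hp : p.IsHomogeneous 1) (h : reesPsi p = 0) :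
    symbolIncl p ∈ kerOneD4 := by
  refine Ideal.subset_span ⟨by rw [RingHom.mem_ker, reesD4_symbolIncl, h], ?_⟩
  refine hp.aeval (n := 1) _ fun i => ?_
  fin_cases i
  · exact (isHomogeneous_X _ _).sub (isHomogeneous_C_mul_X _ _)
  · exact (isHomogeneous_X _ _).sub (isHomogeneous_C_mul_X _ _)
  · exact isHomogeneous_X _ _

theorem isHomogeneous_relOne : (relOne 𝐱 𝐲 𝐳 𝐛 𝐜 𝐞).IsHomogeneous 1 := by
  convert isHomogeneous_linear_form (X 0 ^ 2) (-(5 * (X 0 * X 2 + X 1)))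
    (-(4 * (X 0 * X 2 + X 1) * X 0)) using 1
  simp [relOne, _root_.map_ofNat]
  ring

theorem isHomogeneous_relTwo : (relTwo 𝐱 𝐲 𝐳 𝐛 𝐜 𝐞).IsHomogeneous 1 := by
  convert isHomogeneous_linear_form
    ((X 0 * X 2 + X 1) ^ 2 * (5 * (X 0 * X 2 + X 1) - 16 * X 0 * X 2))
    ((X 0 * X 2 + X 1) * (90 * X 2 ^ 2 * (X 0 * X 2 + X 1) - 40 * X 0 * X 2 ^ 3) +
      5 * X 0 ^ 2 * (X 2 ^ 4 - 1))
    ((X 0 * X 2 + X 1) * (4 * X 2 * (X 0 * X 2 + X 1) ^ 2 +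
      60 * (X 0 * X 2 + X 1) * X 0 * X 2 ^ 2 - 20 * X 0 ^ 2 * X 2 ^ 3)) using 1
  simp [relTwo, relU, relV, _root_.map_ofNat]
  ring

theorem sq_mul_mem_span_of_mem_reesIdeal {p : SymbolRing} (hp : p ∈ reesIdeal) :
    symbolRetr (X 0) ^ 2 * p ∈
      Ideal.span {relOne 𝐱 𝐲 𝐳 𝐛 𝐜 𝐞, relTwo 𝐱 𝐲 𝐳 𝐛 𝐜 𝐞} := by
  obtain ⟨α, q, hq, rfl⟩ := Ideal.mem_span_insert.1 hp
  obtain ⟨β, γ, rfl⟩ := Ideal.mem_span_pair.1 hq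
  rw [Ideal.mem_span_pair, symbolRetr_s]
  refine ⟨C (C 5⁻¹) ^ 2 * ((𝐱 * 𝐛 + (𝐱 * 𝐳 + 𝐲) * 𝐞) ^ 2 * α + γ * (𝐛 ^ 2 * relU 𝐱 𝐲 𝐳 𝐛 𝐜 𝐞 -
      (2 * 𝐱 * 𝐛 * 𝐞 + (𝐱 * 𝐳 + 𝐲) * 𝐞 ^ 2) * relV 𝐳 𝐜)),
    C (C 5⁻¹) ^ 2 * ((𝐱 * 𝐛 + (𝐱 * 𝐳 + 𝐲) * 𝐞) ^ 2 * β + γ * (𝐛 ^ 2 * (4 * 𝐱 * 𝐞 + 5 * 𝐜) +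
      (2 * 𝐱 * 𝐛 * 𝐞 + (𝐱 * 𝐳 + 𝐲) * 𝐞 ^ 2) * 𝐛)), ?_⟩
  rw [relOne, relTwo, relDet]
  ring

theorem s_sq_mul_mem_kerOne {p : MvPolynomial (Fin 4) CoordRing} (hp : reesD4 p = 0) :
    X 0 ^ 2 * p ∈ kerOneD4 := by
  rw [← reesPsi_symbolRetr] at hp
  have hmem := sq_mul_mem_span_of_mem_reesIdeal (mem_reesIdeal_of_reesPsi_eq_zero hp)
  have hle : Ideal.span {relOne 𝐱 𝐲 𝐳 𝐛 𝐜 𝐞, relTwo 𝐱 𝐲 𝐳 𝐛 𝐜 𝐞} ≤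
      kerOneD4.comap symbolIncl := by
    rw [Ideal.span_le]
    rintro _ (rfl | rfl)
    · exact symbolIncl_mem_kerOne isHomogeneous_relOne reesPsi_relOne
    · exact symbolIncl_mem_kerOne isHomogeneous_relTwo reesPsi_relTwo
  have h1 := hle hmem
  rw [Ideal.mem_comap, ← map_pow, ← map_mul] at h1
  exact (Submodule.sub_mem_iff_left _ h1).1 (sub_symbolIncl_symbolRetr_mem _)

section arc

variable {T : Type*} [CommRing T] [Algebra ℂ T]

/-- The arc `x = ε`, `y = z = 0` in the direction `(b, c, e) = (t, t, 0)`. -/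
noncomputable def symbolArc (ε : T) : SymbolRing →+* Polynomial T :=
  symbolHom ![Polynomial.C ε, 0, 0] ![Polynomial.X, Polynomial.X, 0]

theorem symbolArc_relDet (ε : T) :
    symbolArc ε (relDet 𝐱 𝐲 𝐳 𝐛 𝐜 𝐞) = Polynomial.C (-25) * Polynomial.X ^ 2 := by
  rw [map_relDet]
  simp [symbolArc, relDet, relU, relV, _root_.map_ofNat]
  ring

theorem symbolArc_mem_span {ε : T} (hε : ε ^ 2 = 0) {p : SymbolRing} (hp : p ∈ reesIdeal) :
    symbolArc ε p ∈ Ideal.span {Polynomial.X ^ 2} := by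
  have hC : (Polynomial.C ε) ^ 2 = 0 := by rw [← Polynomial.C_pow, hε, Polynomial.C_0]
  refine (Ideal.span_le (I := (Ideal.span {Polynomial.X ^ 2}).comap (symbolArc ε))).2 ?_ hp
  rintro _ (rfl | rfl | rfl)
  · rw [SetLike.mem_coe, Ideal.mem_comap, map_relOne]
    simp [symbolArc, relOne, hC]
  · rw [SetLike.mem_coe, Ideal.mem_comap, map_relTwo]
    simp [symbolArc, relTwo, hC]
  · rw [SetLike.mem_coe, Ideal.mem_comap, symbolArc_relDet]
    exact Ideal.mul_mem_left _ _ (Ideal.subset_span rfl)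

theorem symbolArc_C_mem_range (ε : T) (a : CoordRing) :
    symbolArc ε (C a) ∈ (Polynomial.C : T →+* _).range := by
  induction a using MvPolynomial.induction_on with
  | C r => exact ⟨algebraMap ℂ _ r, by simp [symbolArc, Polynomial.algebraMap_apply]⟩
  | add p q hp hq => rw [map_add, map_add]; exact add_mem hp hq
  | mul_X p i hp =>
    rw [map_mul, map_mul]
    refine mul_mem hp ?_
    fin_cases i
    · exact ⟨ε, by simp [symbolArc]⟩
    · exact ⟨0, by simp [symbolArc]⟩
    · exact ⟨0, by simp [symbolArc]⟩

theorem symbolArc_symbolRetr_s (ε : T) :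
    symbolArc ε (symbolRetr (X 0)) =
      Polynomial.C (algebraMap ℂ _ 5⁻¹ * ε) * Polynomial.X := by
  rw [symbolRetr_s, map_mul, symbolArc, symbolHom_C_C]
  simp [mul_assoc, Polynomial.algebraMap_apply]

theorem exists_symbolArc_eq_C_mul_X (ε : T) {p : MvPolynomial (Fin 4) CoordRing}
    (hp : p.IsHomogeneous 1) :
    ∃ r, symbolArc ε (symbolRetr p) = Polynomial.C r * Polynomial.X := by
  rw [← mem_homogeneousSubmodule, homogeneousSubmodule_one_eq_span_X] at hp
  induction hp using Submodule.span_induction with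
  | mem _ h =>
    obtain ⟨i, rfl⟩ := h
    fin_cases i
    · exact ⟨_, symbolArc_symbolRetr_s ε⟩
    · exact ⟨1, by simp [symbolRetr, symbolArc]⟩
    · exact ⟨0, by simp [symbolRetr, symbolArc]⟩
    · exact ⟨1, by simp [symbolRetr, symbolArc]⟩
  | zero => exact ⟨0, by simp⟩
  | add p q _ _ hp hq =>
    obtain ⟨r, hr⟩ := hp
    obtain ⟨r', hr'⟩ := hq
    exact ⟨r + r', by rw [map_add, map_add, hr, hr', Polynomial.C_add, add_mul]⟩
  | smul a p _ hp =>
    obtain ⟨r, hr⟩ := hp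
    obtain ⟨r', hr'⟩ := symbolArc_C_mem_range ε a
    refine ⟨r' * r, ?_⟩
    rw [map_smul, smul_eq_C_mul, map_mul, hr, ← hr', Polynomial.C_mul, mul_assoc]

theorem symbolArc_symbolRetr_eq_zero {ε : T} (hε : ε ^ 2 = 0)
    {p : MvPolynomial (Fin 4) CoordRing} (hp : p ∈ kerOneD4) :
    symbolArc ε (symbolRetr p) = 0 := by
  refine (Ideal.span_le (I := RingHom.ker ((symbolArc ε).comp symbolRetr.toRingHom))).2 ?_ hp
  rintro q ⟨hq, hq'⟩
  change symbolArc ε (symbolRetr q) = 0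
  have hmem : reesPsi (symbolRetr q) = 0 := (reesPsi_symbolRetr q).trans hq
  obtain ⟨r, hr⟩ := exists_symbolArc_eq_C_mul_X ε hq'
  obtain ⟨g, hg⟩ := Ideal.mem_span_singleton.1
    (symbolArc_mem_span hε (mem_reesIdeal_of_reesPsi_eq_zero hmem))
  have h1 := congrArg (Polynomial.coeff · 1) (hr.symm.trans hg)
  simp [Polynomial.coeff_X_pow_mul'] at h1
  rw [hr, h1, Polynomial.C_0, zero_mul]

theorem s_mul_relDet_notMem_of_ne_zero {ε : T} (hε : ε ^ 2 = 0) (hε0 : ε ≠ 0) :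
    X 0 * symbolIncl (relDet 𝐱 𝐲 𝐳 𝐛 𝐜 𝐞) ∉ kerOneD4 := by
  intro h
  have h0 := symbolArc_symbolRetr_eq_zero hε h
  rw [map_mul, map_mul, symbolRetr_symbolIncl, symbolArc_relDet, symbolArc_symbolRetr_s,
    mul_mul_mul_comm, ← Polynomial.C_mul, ← pow_succ', Polynomial.C_mul_X_pow_eq_monomial,
    Polynomial.monomial_eq_zero_iff, (isUnit_ofNat 25).neg.mul_left_eq_zero,
    ((isUnit_iff_ne_zero.2 (by norm_num)).map (algebraMap ℂ T)).mul_right_eq_zero] at h0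
  exact hε0 h0

end arc

theorem s_mul_relDet_notMem_kerOne :
    X 0 * symbolIncl (relDet 𝐱 𝐲 𝐳 𝐛 𝐜 𝐞) ∉ kerOneD4 := by
  refine s_mul_relDet_notMem_of_ne_zero (T := DualNumber ℂ) (ε := DualNumber.eps) ?_ fun h => ?_
  · rw [pow_two]
    exact DualNumber.eps_mul_eps
  · simpa using congrArg TrivSqZeroExt.snd h

/-- For the divisor `D_4`, with `g_j = ∂f_4/∂x_j`, one has
`s^2·p ∈ ker^{(1)}φ` for every `p ∈ ker φ`, but there exists `p ∈ ker φ` with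
`s^1·p ∉ ker^{(1)}φ`: property (GCL) holds with minimal exponent `N = 2`. -/
theorem D4_GCL_minimal_exponent :
    (∀ p ∈ RingHom.ker (reesPhi fD4 fun j => pderiv j fD4),
      (X 0 : MvPolynomial (Fin 4) (MvPolynomial (Fin 3) ℂ)) ^ 2 * p ∈
        kerOne fD4 fun j => pderiv j fD4) ∧
    (∃ p ∈ RingHom.ker (reesPhi fD4 fun j => pderiv j fD4),
      (X 0 : MvPolynomial (Fin 4) (MvPolynomial (Fin 3) ℂ)) ^ 1 * p ∉
        kerOne fD4 fun j => pderiv j fD4) := by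
  exact ⟨fun p hp => s_sq_mul_mem_kerOne hp, _,
    (reesD4_symbolIncl _).trans reesPsi_relDet, by
      rw [pow_one]
      exact s_mul_relDet_notMem_kerOne⟩
end

section
/- Let A = ℂ[x_1, x_2, x_3], f_4 = (x_1·x_3 + x_2)·(x_1^4 − x_2^4), and g_j = ∂f_4/∂x_j for j = 1, 2, 3. Then ker φ = (ker^{(1)}φ : f_4), i.e. for every p ∈ A[s, ξ_1, ξ_2, ξ_3] one has p ∈ ker φ if and only if f_4·p ∈ ker^{(1)}φ. -/
open MvPolynomial

set_option synthInstance.maxHeartbeats 1000000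
set_option maxHeartbeats 1000000

namespace D4

/-! ### The syzygies of `(f_4, ∂f_4/∂x_1, ∂f_4/∂x_2, ∂f_4/∂x_3)` as polynomials

In the forms below `x, y, z` stand for `x_1, x_2, x_3` and `a, b, w` for `ξ_1, ξ_2, ξ_3`. -/

section Forms

variable {B : Type*} [CommRing B] (x y z s a b w : B)

/-- The syzygy given by the logarithmic vector field `x∂_x + y∂_y`. -/
def eulerForm : B := x * a + y * b - 5 * s

/-- The syzygy given by the logarithmic vector field `(xz + y)∂_z`. -/
def verticalForm : B := (x * z + y) * w - x * s

/-- The syzygy given by the logarithmic vector field `y³∂_x + x³∂_y - x²(1 - z⁴)∂_z`. -/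
def cubicForm : B :=
  y ^ 3 * a + x ^ 3 * b - x ^ 2 * (1 - z ^ 4) * w - z * (y ^ 2 - x * y * z + x ^ 2 * z ^ 2) * s

/-- `verticalForm` with `s` eliminated by means of `eulerForm`. -/
def reducedVertical : B := 5 * (x * z + y) * w - x * (x * a + y * b)

/-- `cubicForm` with `s` eliminated by means of `eulerForm`. -/
def reducedCubic : B :=
  5 * (y ^ 3 * a + x ^ 3 * b - x ^ 2 * (1 - z ^ 4) * w) -
    z * (y ^ 2 - x * y * z + x ^ 2 * z ^ 2) * (x * a + y * b)

/-- The coefficient of `xz + y` in `reducedCubic`. -/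
def cubicLeft : B :=
  (a - z * b) * (5 * (x * z + y) ^ 2 - 16 * x * z * (x * z + y) + 18 * x ^ 2 * z ^ 2) +
    4 * b * z * ((x * z + y) ^ 2 - 3 * x * z * (x * z + y) + 3 * x ^ 2 * z ^ 2)

/-- The coefficient of `x²` in `reducedCubic`. -/
def cubicRight : B := -8 * x * z ^ 3 * (a - z * b) + (1 - z ^ 4) * (5 * b * x - 5 * w)

/-- The determinant expressing `reducedVertical` and `reducedCubic` in terms of `xz + y`
and `x²`; a relation of degree two. -/
def linkDet : B :=
  (5 * w - x * b) * cubicRight x z a b w + (a - z * b) * cubicLeft x y z a b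

/-- The relation `g_3 ξ_2 - g_2 ξ_3`. -/
def koszulForm : B :=
  x * (x ^ 4 - y ^ 4) * b + (4 * x * y ^ 3 * z + 5 * y ^ 4 - x ^ 4) * w

lemma reducedVertical_eq :
    reducedVertical x y z a b w = 5 * verticalForm x y z s w - x * eulerForm x y s a b := by
  unfold reducedVertical verticalForm eulerForm; ring

lemma reducedCubic_eq :
    reducedCubic x y z a b w = 5 * cubicForm x y z s a b w -
      z * (y ^ 2 - x * y * z + x ^ 2 * z ^ 2) * eulerForm x y s a b := by
  unfold reducedCubic cubicForm eulerForm; ring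

lemma mul_linkDet : (x * z + y) * linkDet x y z a b w =
    cubicRight x z a b w * reducedVertical x y z a b w +
      (a - z * b) * reducedCubic x y z a b w := by
  unfold linkDet cubicRight cubicLeft reducedVertical reducedCubic; ring

lemma sq_mul_linkDet : x ^ 2 * linkDet x y z a b w =
    (5 * w - x * b) * reducedCubic x y z a b w -
      cubicLeft x y z a b * reducedVertical x y z a b w := by
  unfold linkDet cubicRight cubicLeft reducedVertical reducedCubic; ring

lemma koszulForm_eq : koszulForm x y z b w =
    x ^ 2 * cubicForm x y z s a b w - y ^ 3 * x * eulerForm x y s a b +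
      (5 * y ^ 3 - x * z * (y ^ 2 - x * y * z + x ^ 2 * z ^ 2)) *
        verticalForm x y z s w := by
  unfold koszulForm cubicForm eulerForm verticalForm; ring

end Forms

/-! ### Divisibility and elimination -/

/-- An element killed by a ring endomorphism that is the identity modulo it is prime. -/
lemma prime_of_retraction {R : Type*} [CommRing R] [IsDomain R] {q : R} (e : R →+* R)
    (hq : q ≠ 0) (heq : e q = 0) (he : ∀ r, q ∣ r - e r) : Prime q := by
  have key : ∀ r, e r = 0 → q ∣ r := fun r hr => by simpa [hr] using he r
  refine ⟨hq, fun hu => ?_, fun u v huv => ?_⟩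
  · have := hu.map e
    rw [heq] at this
    exact not_isUnit_zero this
  · obtain ⟨k, hk⟩ := huv
    have : e u * e v = 0 := by rw [← map_mul, hk, map_mul, heq, zero_mul]
    exact (mul_eq_zero.1 this).imp (key u) (key v)

lemma dvd_of_dvd_prime_mul {R : Type*} [CommRing R] [IsDomain R] {q h p : R} (hq : Prime q)
    (hqh : ¬ q ∣ h) (hd : h ∣ q * p) : h ∣ p := by
  obtain ⟨k, hk⟩ := hd
  obtain ⟨k', rfl⟩ := (hq.dvd_or_dvd ⟨p, hk.symm⟩).resolve_left hqh
  exact ⟨k', mul_left_cancel₀ hq.ne_zero (by rw [hk]; ring)⟩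

lemma dvd_of_dvd_pow_mul {R : Type*} [CommRing R] {g h : R} (hg : ∀ p, h ∣ g * p → h ∣ p) :
    ∀ (n : ℕ) (p : R), h ∣ g ^ n * p → h ∣ p
  | 0, p, hp => by simpa using hp
  | n + 1, p, hp => hg p (dvd_of_dvd_pow_mul hg n _ (by rwa [pow_succ, mul_assoc] at hp))

/-- If, up to powers of `c`, every element of `S` lies modulo `I` in the subalgebra `T`,
then so does every element of the algebra generated by `S`. -/
lemma exists_pow_mul_sub_mem {A B : Type*} [CommRing A] [CommRing B] [Algebra A B]
    (I : Ideal B) (T : Subalgebra A B) (c : A) (S : Set B)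
    (hS : ∀ r ∈ S, ∃ k : ℕ, ∃ t ∈ T, algebraMap A B c ^ k * r - t ∈ I)
    {p : B} (hp : p ∈ Algebra.adjoin A S) :
    ∃ k : ℕ, ∃ t ∈ T, algebraMap A B c ^ k * p - t ∈ I := by
  have hc : ∀ k : ℕ, algebraMap A B c ^ k ∈ T := fun k => pow_mem (T.algebraMap_mem c) k
  induction hp using Algebra.adjoin_induction with
  | mem r hr => exact hS r hr
  | algebraMap r => exact ⟨0, _, T.algebraMap_mem r, by simp⟩
  | add u v _ _ hu hv =>
    obtain ⟨k, t, ht, hk⟩ := hu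
    obtain ⟨l, t', ht', hl⟩ := hv
    refine ⟨k + l, algebraMap A B c ^ l * t + algebraMap A B c ^ k * t',
      T.add_mem (T.mul_mem (hc l) ht) (T.mul_mem (hc k) ht'), ?_⟩
    convert I.add_mem (I.mul_mem_left (algebraMap A B c ^ l) hk)
      (I.mul_mem_left (algebraMap A B c ^ k) hl) using 1
    ring
  | mul u v _ _ hu hv =>
    obtain ⟨k, t, ht, hk⟩ := hu
    obtain ⟨l, t', ht', hl⟩ := hv
    refine ⟨k + l, t * t', T.mul_mem ht ht', ?_⟩
    convert I.add_mem (I.mul_mem_left (algebraMap A B c ^ l * v) hk)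
      (I.mul_mem_left t hl) using 1
    ring

/-- The ideal generated by the reduced syzygies and the quadratic relation. -/
def linkIdeal {B : Type*} [CommRing B] (x y z a b w : B) : Ideal B :=
  Ideal.span {reducedVertical x y z a b w, reducedCubic x y z a b w, linkDet x y z a b w}

lemma mem_linkIdeal {B : Type*} [CommRing B] {x y z a b w p : B} :
    p ∈ linkIdeal x y z a b w ↔ ∃ m n k, m * reducedVertical x y z a b w +
      n * reducedCubic x y z a b w + k * linkDet x y z a b w = p := by
  simp only [linkIdeal, Ideal.mem_span_insert, Ideal.mem_span_singleton']
  constructor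
  · rintro ⟨m, _, ⟨n, _, ⟨k, rfl⟩, rfl⟩, rfl⟩
    exact ⟨m, n, k, by ring⟩
  · rintro ⟨m, n, k, rfl⟩
    exact ⟨m, _, ⟨n, _, ⟨k, rfl⟩, rfl⟩, by ring⟩

/-- `x` is a nonzerodivisor modulo `linkIdeal`. -/
lemma mem_linkIdeal_of_mul_mem {R : Type*} [CommRing R] [IsDomain R] {x y z a b w : R}
    (e : R →+* R) (he : ∀ r, x ∣ r - e r) (hx : x ≠ 0) (ex : e x = 0) (ey : e y = y)
    (ez : e z = z) (ea : e a = a) (eb : e b = b) (ew : e w = w) (hy : Prime y)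
    (hw : Prime (5 * w)) (hyw : ¬ y ∣ linkDet 0 y z a b w)
    (hwa : ¬ 5 * w ∣ cubicLeft 0 y z a b) {p : R} (hp : x * p ∈ linkIdeal x y z a b w) :
    p ∈ linkIdeal x y z a b w := by
  obtain ⟨m, n, k, h⟩ := mem_linkIdeal.1 hp
  have h0 := congrArg e h
  simp only [reducedVertical, reducedCubic, linkDet, cubicLeft, cubicRight, map_add, map_sub,
    map_mul, map_pow, map_neg, map_one, map_ofNat, ex, ey, ez, ea, eb, ew] at h0
  obtain ⟨m', hm⟩ := he m
  obtain ⟨n', hn⟩ := he n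
  obtain ⟨k', hk⟩ := he k
  obtain ⟨i, hi⟩ : y ∣ e k := by
    refine (hy.dvd_or_dvd (b := linkDet 0 y z a b w)
      ⟨-(e m * (5 * w) + e n * (y ^ 2 * (5 * a - z * b))), ?_⟩).resolve_right hyw
    simp only [linkDet, cubicLeft, cubicRight]
    linear_combination h0
  rw [hi] at h0 hk
  have h1 : 5 * w * (e m + i * cubicRight 0 z a b w) +
      cubicLeft 0 y z a b * (e n + i * (a - z * b)) = 0 := by
    refine mul_left_cancel₀ hy.ne_zero ?_
    simp only [cubicLeft, cubicRight]
    linear_combination h0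
  obtain ⟨j, hj⟩ : 5 * w ∣ e n + i * (a - z * b) :=
    (hw.dvd_or_dvd (a := cubicLeft 0 y z a b)
      ⟨-(e m + i * cubicRight 0 z a b w), by linear_combination h1⟩).resolve_left hwa
  have h2 : e m + i * cubicRight 0 z a b w + cubicLeft 0 y z a b * j = 0 := by
    refine mul_left_cancel₀ hw.ne_zero ?_
    linear_combination h1 - cubicLeft 0 y z a b * hj
  have hL : x ∣ cubicLeft x y z a b - cubicLeft 0 y z a b := by
    convert he (cubicLeft x y z a b) using 2
    simp [cubicLeft, map_ofNat, ex, ey, ez, ea, eb]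
  have hR : x ∣ cubicRight x z a b w - cubicRight 0 z a b w := by
    convert he (cubicRight x z a b w) using 2
    simp [cubicRight, map_ofNat, ex, ez, ea, eb, ew]
  obtain ⟨l, hl⟩ := hL
  obtain ⟨r, hr⟩ := hR
  refine mem_linkIdeal.2 ⟨m' + i * r + j * l, n' + j * b, k' - i * z + j * x, ?_⟩
  refine mul_left_cancel₀ hx ?_
  linear_combination h - i * mul_linkDet x y z a b w + j * sq_mul_linkDet x y z a b w
    - reducedVertical x y z a b w * (hm + h2 + i * hr + j * hl)
    - reducedCubic x y z a b w * (hn + hj) - linkDet x y z a b w * hk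

/-! ### The polynomial ring `A[s, ξ_1, ξ_2, ξ_3]` -/

/-- The ring `A[s, ξ_1, ξ_2, ξ_3]` with `A = ℂ[x_1, x_2, x_3]`. -/
abbrev SymRing : Type := MvPolynomial (Fin 4) (MvPolynomial (Fin 3) ℂ)

local notation "x₁" => (C (X 0) : SymRing)
local notation "x₂" => (C (X 1) : SymRing)
local notation "x₃" => (C (X 2) : SymRing)
local notation "s₀" => (X 0 : SymRing)
local notation "ξ₁" => (X 1 : SymRing)
local notation "ξ₂" => (X 2 : SymRing)
local notation "ξ₃" => (X 3 : SymRing)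

/-- Substitution of values for all seven variables. -/
noncomputable def subst {B : Type*} [CommRing B] [Algebra ℂ B] (u : Fin 3 → B) (v : Fin 4 → B) :
    SymRing →+* B :=
  eval₂Hom (aeval u : MvPolynomial (Fin 3) ℂ →ₐ[ℂ] B).toRingHom v

section Subst

variable {B : Type*} [CommRing B] [Algebra ℂ B] (u : Fin 3 → B) (v : Fin 4 → B)

@[simp] lemma subst_X (j : Fin 4) : subst u v (X j) = v j := by simp [subst]

@[simp] lemma subst_C_X (i : Fin 3) : subst u v (C (X i)) = u i := by simp [subst]

@[simp] lemma subst_C_C (c : ℂ) : subst u v (C (C c)) = algebraMap ℂ B c := by simp [subst]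

end Subst

lemma sub_subst_mem (I : Ideal SymRing) (u : Fin 3 → SymRing) (v : Fin 4 → SymRing)
    (hu : ∀ i, C (X i) - u i ∈ I) (hv : ∀ j, X j - v j ∈ I) (r : SymRing) :
    r - subst u v r ∈ I := by
  rw [← Ideal.Quotient.eq]
  have : Ideal.Quotient.mk I = (Ideal.Quotient.mk I).comp (subst u v) := by
    refine MvPolynomial.ringHom_ext' (MvPolynomial.ringHom_ext' ?_ fun i => ?_) fun j => ?_
    · ext c
      simp only [RingHom.comp_apply, subst_C_C]
      rfl
    · simpa using Ideal.Quotient.eq.2 (hu i)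
    · simpa using Ideal.Quotient.eq.2 (hv j)
  exact congrArg (fun g : SymRing →+* SymRing ⧸ I => g r) this

lemma dvd_sub_subst {q : SymRing} {u : Fin 3 → SymRing} {v : Fin 4 → SymRing}
    (hu : ∀ i, q ∣ C (X i) - u i) (hv : ∀ j, q ∣ X j - v j) (r : SymRing) :
    q ∣ r - subst u v r := by
  simp only [← Ideal.mem_span_singleton] at *
  exact sub_subst_mem _ u v hu hv r

lemma ne_zero_of_map_ne_zero {R S : Type*} [CommRing R] [CommRing S] {q : R} (e : R →+* S)
    (h : e q ≠ 0) : q ≠ 0 := fun h0 => h (by simp [h0])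

lemma not_dvd_of_map {R S : Type*} [CommRing R] [CommRing S] {q p : R} (e : R →+* S)
    (hq : e q = 0) (hp : e p ≠ 0) : ¬ q ∣ p := fun h =>
  hp (zero_dvd_iff.1 (hq ▸ map_dvd e h))

lemma prime_x : Prime x₁ := by
  refine prime_of_retraction (subst ![0, x₂, x₃] ![s₀, ξ₁, ξ₂, ξ₃]) ?_ (by simp)
    (dvd_sub_subst (fun i => ?_) fun j => ?_)
  · exact ne_zero_of_map_ne_zero (subst (B := ℂ) ![1, 0, 0] ![0, 0, 0, 0]) (by simp)
  · fin_cases i <;> simp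
  · fin_cases j <;> simp

lemma prime_y_sub (c : ℂ) : Prime (x₂ - C (C c) * x₁) := by
  refine prime_of_retraction (subst ![x₁, C (C c) * x₁, x₃] ![s₀, ξ₁, ξ₂, ξ₃]) ?_
    (by simp [MvPolynomial.algebraMap_apply]) (dvd_sub_subst (fun i => ?_) fun j => ?_)
  · exact ne_zero_of_map_ne_zero (subst (B := ℂ) ![0, 1, 0] ![0, 0, 0, 0]) (by simp)
  · fin_cases i <;> simp
  · fin_cases j <;> simp

lemma prime_y : Prime x₂ := by simpa using prime_y_sub 0

lemma isUnit_five : IsUnit (5 : SymRing) := by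
  have : IsUnit (5 : ℂ) := by simp
  simpa [map_ofNat] using this.map (algebraMap ℂ SymRing)

lemma prime_five_w : Prime (5 * ξ₃) := by
  refine prime_of_retraction (subst ![x₁, x₂, x₃] ![s₀, ξ₁, ξ₂, 0]) ?_ (by simp)
    (dvd_sub_subst (fun i => ?_) fun j => ?_)
  · exact ne_zero_of_map_ne_zero (subst (B := ℂ) ![0, 0, 0] ![0, 0, 0, 1])
      (by simp [map_ofNat])
  · fin_cases i <;> simp
  · fin_cases j <;> simp [isUnit_five.mul_left_dvd]

/-- The ideal generated by the three syzygies. -/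
noncomputable def syzIdeal : Ideal SymRing :=
  Ideal.span {eulerForm x₁ x₂ s₀ ξ₁ ξ₂, verticalForm x₁ x₂ x₃ s₀ ξ₃,
    cubicForm x₁ x₂ x₃ s₀ ξ₁ ξ₂ ξ₃}

lemma eulerForm_mem : eulerForm x₁ x₂ s₀ ξ₁ ξ₂ ∈ syzIdeal := Ideal.subset_span (by simp)

lemma verticalForm_mem : verticalForm x₁ x₂ x₃ s₀ ξ₃ ∈ syzIdeal := Ideal.subset_span (by simp)

lemma cubicForm_mem : cubicForm x₁ x₂ x₃ s₀ ξ₁ ξ₂ ξ₃ ∈ syzIdeal := Ideal.subset_span (by simp)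

lemma reducedVertical_mem : reducedVertical x₁ x₂ x₃ ξ₁ ξ₂ ξ₃ ∈ syzIdeal := by
  rw [reducedVertical_eq _ _ _ s₀]
  exact sub_mem (Ideal.mul_mem_left _ _ verticalForm_mem) (Ideal.mul_mem_left _ _ eulerForm_mem)

lemma reducedCubic_mem : reducedCubic x₁ x₂ x₃ ξ₁ ξ₂ ξ₃ ∈ syzIdeal := by
  rw [reducedCubic_eq _ _ _ s₀]
  exact sub_mem (Ideal.mul_mem_left _ _ cubicForm_mem) (Ideal.mul_mem_left _ _ eulerForm_mem)

lemma koszulForm_mem : koszulForm x₁ x₂ x₃ ξ₂ ξ₃ ∈ syzIdeal := by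
  rw [koszulForm_eq _ _ _ s₀ ξ₁]
  exact add_mem (sub_mem (Ideal.mul_mem_left _ _ cubicForm_mem)
    (Ideal.mul_mem_left _ _ eulerForm_mem)) (Ideal.mul_mem_left _ _ verticalForm_mem)

lemma mem_linkIdeal_of_x_mul_mem {p : SymRing} (hp : x₁ * p ∈ linkIdeal x₁ x₂ x₃ ξ₁ ξ₂ ξ₃) :
    p ∈ linkIdeal x₁ x₂ x₃ ξ₁ ξ₂ ξ₃ := by
  refine mem_linkIdeal_of_mul_mem (subst ![0, x₂, x₃] ![s₀, ξ₁, ξ₂, ξ₃])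
    (dvd_sub_subst (fun i => ?_) fun j => ?_) prime_x.ne_zero (by simp) (by simp) (by simp)
    (by simp) (by simp) (by simp) prime_y prime_five_w ?_ ?_ hp
  · fin_cases i <;> simp
  · fin_cases j <;> simp
  · exact not_dvd_of_map (subst (B := ℂ) ![0, 0, 0] ![0, 0, 0, 1]) (by simp)
      (by simp [linkDet, cubicLeft, cubicRight, map_ofNat])
  · exact not_dvd_of_map (subst (B := ℂ) ![0, 1, 0] ![0, 1, 0, 0]) (by simp)
      (by simp [cubicLeft, map_ofNat])

/-- Elimination of `s` by means of the Euler relation. -/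
noncomputable def elimS : SymRing →+* SymRing :=
  subst ![x₁, x₂, x₃] ![C (C (1 / 5)) * (x₁ * ξ₁ + x₂ * ξ₂), ξ₁, ξ₂, ξ₃]

lemma C_fifth_mul_five : (C (C (1 / 5)) : SymRing) * 5 = 1 := by
  have : (5 : SymRing) = C (C 5) := by simp [map_ofNat]
  rw [this, ← map_mul, ← map_mul]
  norm_num

lemma sub_elimS_mem (p : SymRing) : p - elimS p ∈ syzIdeal := by
  refine sub_subst_mem _ _ _ (fun i => ?_) (fun j => ?_) p
  · fin_cases i <;> simp
  · fin_cases j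
    · convert syzIdeal.mul_mem_left (-C (C (1 / 5))) eulerForm_mem using 1
      simp only [eulerForm, Fin.zero_eta, Matrix.cons_val_zero]
      linear_combination -s₀ * C_fifth_mul_five
    all_goals simp

lemma elimS_mem_linkIdeal {p : SymRing} (hp : p ∈ syzIdeal) :
    elimS p ∈ linkIdeal x₁ x₂ x₃ ξ₁ ξ₂ ξ₃ := by
  have h5 : (5 : SymRing) * C (C (1 / 5)) = 1 := by rw [mul_comm, C_fifth_mul_five]
  have he : elimS (eulerForm x₁ x₂ s₀ ξ₁ ξ₂) = 0 := by
    simp only [elimS, eulerForm, map_add, map_sub, map_mul, map_ofNat, subst_X, subst_C_X,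
      Matrix.cons_val]
    linear_combination -(x₁ * ξ₁ + x₂ * ξ₂) * h5
  have hv : elimS (verticalForm x₁ x₂ x₃ s₀ ξ₃) =
      C (C (1 / 5)) * reducedVertical x₁ x₂ x₃ ξ₁ ξ₂ ξ₃ := by
    simp only [elimS, verticalForm, reducedVertical, map_add, map_sub, map_mul, subst_X,
      subst_C_X, Matrix.cons_val]
    linear_combination -((x₁ * x₃ + x₂) * ξ₃) * h5
  have hc : elimS (cubicForm x₁ x₂ x₃ s₀ ξ₁ ξ₂ ξ₃) =
      C (C (1 / 5)) * reducedCubic x₁ x₂ x₃ ξ₁ ξ₂ ξ₃ := by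
    simp only [elimS, cubicForm, reducedCubic, map_add, map_sub, map_mul, map_pow, map_one,
      subst_X, subst_C_X, Matrix.cons_val]
    linear_combination
      -(x₂ ^ 3 * ξ₁ + x₁ ^ 3 * ξ₂ - x₁ ^ 2 * (1 - x₃ ^ 4) * ξ₃) * h5
  have hle : syzIdeal ≤ (linkIdeal x₁ x₂ x₃ ξ₁ ξ₂ ξ₃).comap elimS := by
    rw [syzIdeal, Ideal.span_le]
    rintro _ (rfl | rfl | rfl)
    · simp [he]
    · rw [SetLike.mem_coe, Ideal.mem_comap, hv]
      exact Ideal.mul_mem_left _ _ (Ideal.subset_span (by simp))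
    · rw [SetLike.mem_coe, Ideal.mem_comap, hc]
      exact Ideal.mul_mem_left _ _ (Ideal.subset_span (by simp))
  exact hle hp

/-- Saturating `syzIdeal` with respect to `x_1` amounts to multiplying by `x_1 x_3 + x_2`. -/
lemma mul_mem_syzIdeal_of_pow_mul_mem {p : SymRing} {k : ℕ} (hp : x₁ ^ k * p ∈ syzIdeal) :
    (x₁ * x₃ + x₂) * p ∈ syzIdeal := by
  have h1 : x₁ ^ k * elimS p ∈ linkIdeal x₁ x₂ x₃ ξ₁ ξ₂ ξ₃ := by
    simpa [elimS] using elimS_mem_linkIdeal hp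
  have h2 : elimS p ∈ linkIdeal x₁ x₂ x₃ ξ₁ ξ₂ ξ₃ := by
    clear hp
    induction k with
    | zero => simpa using h1
    | succ k ih => exact ih (mem_linkIdeal_of_x_mul_mem (by rwa [← mul_assoc, ← pow_succ']))
  obtain ⟨m, n, l, h⟩ := mem_linkIdeal.1 h2
  have h3 : (x₁ * x₃ + x₂) * elimS p ∈ syzIdeal := by
    convert add_mem
      (syzIdeal.mul_mem_left ((x₁ * x₃ + x₂) * m + l * cubicRight x₁ x₃ ξ₁ ξ₂ ξ₃)
        reducedVertical_mem)
      (syzIdeal.mul_mem_left ((x₁ * x₃ + x₂) * n + l * (ξ₁ - x₃ * ξ₂)) reducedCubic_mem) using 1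
    linear_combination -(x₁ * x₃ + x₂) * h + l * mul_linkDet x₁ x₂ x₃ ξ₁ ξ₂ ξ₃
  convert add_mem h3 (syzIdeal.mul_mem_left (x₁ * x₃ + x₂) (sub_elimS_mem p)) using 1
  ring

lemma not_y_sub_dvd_koszulForm {c : ℂ} (hc : c ^ 4 = 1) :
    ¬ x₂ - C (C c) * x₁ ∣ koszulForm x₁ x₂ x₃ ξ₂ ξ₃ := by
  refine not_dvd_of_map (subst (B := ℂ) ![1, c, 0] ![0, 0, 0, 1]) (by simp) ?_
  simp only [koszulForm, map_add, map_sub, map_mul, map_pow, map_ofNat, subst_X, subst_C_X,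
    Matrix.cons_val, hc]
  norm_num

lemma not_x_dvd_koszulForm : ¬ x₁ ∣ koszulForm x₁ x₂ x₃ ξ₂ ξ₃ := by
  refine not_dvd_of_map (subst (B := ℂ) ![0, 1, 0] ![0, 0, 0, 1]) (by simp) ?_
  simp [koszulForm, map_ofNat]

lemma koszulForm_dvd_of_dvd_mul {p : SymRing}
    (hp : koszulForm x₁ x₂ x₃ ξ₂ ξ₃ ∣ x₁ * (x₁ ^ 4 - x₂ ^ 4) * p) :
    koszulForm x₁ x₂ x₃ ξ₂ ξ₃ ∣ p := by
  have hI : (C (C Complex.I) : SymRing) ^ 2 = -1 := by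
    rw [← map_pow, ← map_pow, Complex.I_sq]; simp
  have hfac : x₁ * (x₁ ^ 4 - x₂ ^ 4) * p = x₁ * ((x₂ - C (C 1) * x₁) *
      ((x₂ - C (C (-1)) * x₁) * ((x₂ - C (C Complex.I) * x₁) *
        ((x₂ - C (C (-Complex.I)) * x₁) * -p)))) := by
    simp only [map_one, map_neg]
    linear_combination -(x₁ * x₁ ^ 2 * (x₂ ^ 2 - x₁ ^ 2) * p) * hI
  rw [hfac] at hp
  have hI4 : (-Complex.I) ^ 4 = 1 := by simp [Even.neg_pow (show Even 4 by decide)]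
  have h1 := dvd_of_dvd_prime_mul prime_x not_x_dvd_koszulForm hp
  have h2 := dvd_of_dvd_prime_mul (prime_y_sub _) (not_y_sub_dvd_koszulForm (by norm_num)) h1
  have h3 := dvd_of_dvd_prime_mul (prime_y_sub _) (not_y_sub_dvd_koszulForm (by norm_num)) h2
  have h4 := dvd_of_dvd_prime_mul (prime_y_sub _) (not_y_sub_dvd_koszulForm Complex.I_pow_four) h3
  have h5 := dvd_of_dvd_prime_mul (prime_y_sub _) (not_y_sub_dvd_koszulForm hI4) h4
  exact (dvd_neg).1 h5

/-- Up to powers of `x_1`, the variables `s` and `ξ_1` can be eliminated modulo `syzIdeal`. -/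
lemma exists_x_pow_mul_sub_mem (p : SymRing) : ∃ k : ℕ,
    ∃ t ∈ Algebra.adjoin (MvPolynomial (Fin 3) ℂ) {ξ₂, ξ₃}, x₁ ^ k * p - t ∈ syzIdeal := by
  have hp : p ∈ Algebra.adjoin (MvPolynomial (Fin 3) ℂ)
      (Set.range (X : Fin 4 → SymRing)) := by
    rw [adjoin_range_X]; trivial
  refine exists_pow_mul_sub_mem syzIdeal _ (X 0) _ ?_ hp
  set T := Algebra.adjoin (MvPolynomial (Fin 3) ℂ) ({ξ₂, ξ₃} : Set SymRing)
  have hC : ∀ c, (C c : SymRing) ∈ T := T.algebraMap_mem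
  have h2 : ξ₂ ∈ T := Algebra.subset_adjoin (by simp)
  have h3 : ξ₃ ∈ T := Algebra.subset_adjoin (by simp)
  have hl : x₁ * x₃ + x₂ ∈ T := T.add_mem (T.mul_mem (hC _) (hC _)) (hC _)
  rw [algebraMap_eq]
  rintro _ ⟨j, rfl⟩
  fin_cases j
  · refine ⟨1, _, T.mul_mem hl h3, ?_⟩
    convert neg_mem verticalForm_mem using 1
    simp [verticalForm]
  · refine ⟨2, _, T.sub_mem (T.mul_mem (T.mul_mem (T.algebraMap_mem 5) hl) h3)
      (T.mul_mem (T.mul_mem (hC (X 0)) (hC (X 1))) h2), ?_⟩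
    convert neg_mem reducedVertical_mem using 1
    simp [reducedVertical, map_ofNat]
    ring
  · exact ⟨0, _, h2, by simp⟩
  · exact ⟨0, _, h3, by simp⟩

/-- Up to powers of `g_3`, the variable `ξ_2` can be eliminated modulo `koszulForm`. -/
lemma exists_pow_mul_sub_mem_span_koszulForm {p : SymRing}
    (hp : p ∈ Algebra.adjoin (MvPolynomial (Fin 3) ℂ) {ξ₂, ξ₃}) :
    ∃ k : ℕ, ∃ q : Polynomial (MvPolynomial (Fin 3) ℂ),
      koszulForm x₁ x₂ x₃ ξ₂ ξ₃ ∣ (x₁ * (x₁ ^ 4 - x₂ ^ 4)) ^ k * p - Polynomial.aeval ξ₃ q := by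
  set T := Algebra.adjoin (MvPolynomial (Fin 3) ℂ) ({ξ₃} : Set SymRing) with hT
  have hC : ∀ c, (C c : SymRing) ∈ T := T.algebraMap_mem
  have h3 : ξ₃ ∈ T := Algebra.subset_adjoin (by simp)
  obtain ⟨k, t, ht, h⟩ := exists_pow_mul_sub_mem
    (Ideal.span {koszulForm x₁ x₂ x₃ ξ₂ ξ₃}) T (X 0 * (X 0 ^ 4 - X 1 ^ 4)) {ξ₂, ξ₃} (by
      rintro _ (rfl | rfl)
      · refine ⟨1, _, T.mul_mem (hC (-(4 * X 0 * X 1 ^ 3 * X 2 + 5 * X 1 ^ 4 - X 0 ^ 4))) h3, ?_⟩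
        convert Ideal.mem_span_singleton_self _ using 1
        simp [koszulForm, map_ofNat]
        ring
      · exact ⟨0, _, h3, by simp⟩) hp
  rw [hT, Algebra.adjoin_singleton_eq_range_aeval] at ht
  obtain ⟨q, rfl⟩ := ht
  refine ⟨k, q, ?_⟩
  rw [Ideal.mem_span_singleton, algebraMap_eq] at h
  simpa using h

/-! ### The kernel of `φ` -/

/-- The map `φ` for the divisor `D_4`. -/
noncomputable abbrev phi : SymRing →ₐ[MvPolynomial (Fin 3) ℂ] Polynomial (MvPolynomial (Fin 3) ℂ) :=
  reesPhi fD4 fun j => pderiv j fD4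

lemma phi_s : phi s₀ =
    Polynomial.C ((X 0 * X 2 + X 1) * (X 0 ^ 4 - X 1 ^ 4)) * Polynomial.X := by
  simp [phi, reesPhi, fD4]

lemma phi_succ (j : Fin 3) :
    phi (X j.succ) = Polynomial.C (pderiv j fD4) * Polynomial.X := by
  simp [phi, reesPhi]

lemma phi_one : phi ξ₁ = Polynomial.C
    (X 2 * (X 0 ^ 4 - X 1 ^ 4) + (X 0 * X 2 + X 1) * (4 * X 0 ^ 3)) * Polynomial.X := by
  have : pderiv 0 fD4 = X 2 * (X 0 ^ 4 - X 1 ^ 4) + (X 0 * X 2 + X 1) * (4 * X 0 ^ 3) := by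
    simp [fD4, Derivation.leibniz, Derivation.leibniz_pow, pderiv_X]
    ring
  rw [← this]
  exact phi_succ 0

lemma phi_two : phi ξ₂ = Polynomial.C
    ((X 0 ^ 4 - X 1 ^ 4) - (X 0 * X 2 + X 1) * (4 * X 1 ^ 3)) * Polynomial.X := by
  have : pderiv 1 fD4 = (X 0 ^ 4 - X 1 ^ 4) - (X 0 * X 2 + X 1) * (4 * X 1 ^ 3) := by
    simp [fD4, Derivation.leibniz, Derivation.leibniz_pow, pderiv_X]
    ring
  rw [← this]
  exact phi_succ 1

lemma phi_three : phi ξ₃ = Polynomial.C (X 0 * (X 0 ^ 4 - X 1 ^ 4)) * Polynomial.X := by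
  have : pderiv 2 fD4 = X 0 * (X 0 ^ 4 - X 1 ^ 4) := by
    simp [fD4, Derivation.leibniz, Derivation.leibniz_pow, pderiv_X]
    ring
  rw [← this]
  exact phi_succ 2

lemma phi_C (c : MvPolynomial (Fin 3) ℂ) : phi (C c) = Polynomial.C c := by
  simp [phi, reesPhi]

lemma syzIdeal_le_kerOne : syzIdeal ≤ kerOne fD4 fun j => pderiv j fD4 := by
  have hX : ∀ j : Fin 4, (X j : SymRing).IsHomogeneous 1 := isHomogeneous_X _
  have hC : ∀ (c : MvPolynomial (Fin 3) ℂ) (j : Fin 4),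
      (C c * X j : SymRing).IsHomogeneous 1 := fun c j => isHomogeneous_C_mul_X c j
  have h5 : (5 : SymRing) = C 5 := by simp [map_ofNat]
  rw [syzIdeal, Ideal.span_le]
  rintro _ (rfl | rfl | rfl)
  · refine Ideal.subset_span ⟨?_, ?_⟩
    · change phi _ = 0
      simp only [eulerForm, map_add, map_sub, map_mul, map_ofNat, phi_C, phi_s, phi_one, phi_two,
        map_pow]
      ring
    · rw [eulerForm, h5]
      exact ((hC _ _).add (hC _ _)).sub (hC _ _)
  · refine Ideal.subset_span ⟨?_, ?_⟩
    · change phi _ = 0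
      simp only [verticalForm, map_add, map_sub, map_mul, phi_C, phi_s, phi_three, map_pow]
      ring
    · rw [verticalForm, ← map_mul, ← map_add]
      exact (hC _ _).sub (hC _ _)
  · refine Ideal.subset_span ⟨?_, ?_⟩
    · change phi _ = 0
      simp only [cubicForm, map_add, map_sub, map_mul, map_ofNat, map_one, phi_C, phi_s, phi_one,
        phi_two, phi_three, map_pow]
      ring
    · simp only [cubicForm, ← map_mul, ← map_add, ← map_sub, ← map_pow, ← map_one C]
      exact (((hC _ _).add (hC _ _)).sub (hC _ _)).sub (hC _ _)

lemma kerOne_le_ker : (kerOne fD4 fun j => pderiv j fD4) ≤ RingHom.ker phi :=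
  Ideal.span_le.2 fun _ hp => hp.1

lemma partial_three_ne_zero : (X 0 * (X 0 ^ 4 - X 1 ^ 4) : MvPolynomial (Fin 3) ℂ) ≠ 0 :=
  ne_zero_of_map_ne_zero (aeval (R := ℂ) (S₁ := ℂ) ![1, 0, 0]).toRingHom (by simp)

lemma fD4_ne_zero : fD4 ≠ 0 :=
  ne_zero_of_map_ne_zero (aeval (R := ℂ) (S₁ := ℂ) ![1, 0, 1]).toRingHom (by simp [fD4])

lemma mul_mem_syzIdeal_of_mem_ker {p : SymRing} (hp : phi p = 0) :
    (x₁ * x₃ + x₂) * p ∈ syzIdeal := by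
  have hker : ∀ r ∈ syzIdeal, phi r = 0 := fun r hr => kerOne_le_ker (syzIdeal_le_kerOne hr)
  obtain ⟨k, t, ht, hk⟩ := exists_x_pow_mul_sub_mem p
  have hphit : phi t = 0 := by simpa [hp] using hker _ hk
  obtain ⟨l, q, hq⟩ := exists_pow_mul_sub_mem_span_koszulForm ht
  have hphiq : phi (Polynomial.aeval ξ₃ q) = 0 := by
    obtain ⟨r, hr⟩ := hq
    have := congrArg phi hr
    rw [map_mul, hker _ koszulForm_mem, zero_mul, map_sub, map_mul, hphit, mul_zero,
      zero_sub, neg_eq_zero] at this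
    exact this
  have hq0 : q = 0 := by
    rw [← Polynomial.aeval_algHom_apply, phi_three, ← Polynomial.comp_eq_aeval] at hphiq
    ext1 n
    have h := congrArg (fun r => Polynomial.coeff r n) hphiq
    rw [Polynomial.comp_C_mul_X_coeff, Polynomial.coeff_zero] at h
    exact (mul_eq_zero.1 h).resolve_right (pow_ne_zero _ partial_three_ne_zero)
  rw [hq0, map_zero, sub_zero] at hq
  have ht' : t ∈ syzIdeal :=
    syzIdeal.mem_of_dvd (dvd_of_dvd_pow_mul (fun _ => koszulForm_dvd_of_dvd_mul) l t hq)
      koszulForm_mem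
  exact mul_mem_syzIdeal_of_pow_mul_mem (by simpa using add_mem hk ht')

end D4

/-- For the divisor `D_4`, with `g_j = ∂f_4/∂x_j`, one has
`ker φ = (ker^{(1)}φ : f_4)`: a polynomial `p ∈ A[s, ξ_1, ξ_2, ξ_3]` lies in `ker φ` if
and only if `f_4·p ∈ ker^{(1)}φ` (here `f_4` is regarded as a constant polynomial). -/
theorem D4_ker_eq_colon :
    ∀ p : MvPolynomial (Fin 4) (MvPolynomial (Fin 3) ℂ),
      p ∈ RingHom.ker (reesPhi fD4 fun j => pderiv j fD4) ↔
        C fD4 * p ∈ kerOne fD4 fun j => pderiv j fD4 := by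
  intro p
  constructor
  · intro hp
    convert Ideal.mul_mem_left _ (C (X 0 ^ 4 - X 1 ^ 4))
      (D4.syzIdeal_le_kerOne (D4.mul_mem_syzIdeal_of_mem_ker hp)) using 1
    simp only [fD4, map_mul, map_add]
    ring
  · intro hp
    have h : D4.phi (C fD4 * p) = 0 := D4.kerOne_le_ker hp
    rw [map_mul, D4.phi_C] at h
    exact (mul_eq_zero.1 h).resolve_left (by simpa using D4.fD4_ne_zero)
end
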